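/- Assume A satisfies condition (103) and f satisfies condition (109). Let a > 0, 0 < R ≤ ∞, and let φ be a positive solution of the Cauchy problem (204) on [0,R). Then for every r ∈ (0,R): C(n,k)^{−1/k}·r·f(a) ≤ A(φ′(r))φ′(r) ≤ C(n,k)^{−1/k}·r·f(φ(r)). -/

import Mathlib

open Filter MeasureTheory Set Topology
open scoped ENNReal

noncomputable section

abbrev Euc (n : ℕ) := EuclideanSpace ℝ (Fin n)

/-- k-th elementary symmetric function of λ ∈ ℝⁿ. -/
def sigmaElem (n k : ℕ) (lam : Fin n → ℝ) : ℝ :=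
  ∑ S ∈ Finset.powersetCard k (Finset.univ : Finset (Fin n)), ∏ i ∈ S, lam i

/-- The cone Γ_k. -/
def GammaK (n k : ℕ) : Set (Fin n → ℝ) :=
  {lam | ∀ l, 1 ≤ l → l ≤ k → 0 < sigmaElem n l lam}

/-- Matrix (D_i V_j) of a vector field V. -/
def jacMatrix {n : ℕ} (V : Euc n → Euc n) (x : Euc n) : Matrix (Fin n) (Fin n) ℝ :=
  fun i j => fderiv ℝ (fun y => V y j) x (EuclideanSpace.single i 1)

/-- Condition (103). -/
def Cond103 (A : ℝ → ℝ) : Prop :=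
  ContDiffOn ℝ 1 A (Ioi 0) ∧ (∀ p ∈ Ioi (0:ℝ), 0 < A p) ∧
  ContinuousOn (fun p => p * A p) (Ici 0) ∧
  StrictMonoOn (fun p => p * A p) (Ioi 0)

/-- Condition (109). -/
def Cond109 (f : ℝ → ℝ) : Prop :=
  ContinuousOn f (Ioi 0) ∧ (∀ t ∈ Ioi (0:ℝ), 0 < f t) ∧ MonotoneOn f (Ioi 0)

/-- Condition (117). -/
def Cond117 (f : ℝ → ℝ) : Prop :=
  Continuous f ∧ (∀ t, 0 < f t) ∧ Monotone f

/-- Condition (108): 0 < liminf A(p)/p^{m-2} ≤ limsup A(p)/p^{m-2} < ∞. -/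
def Cond108 (A : ℝ → ℝ) (m : ℝ) : Prop :=
  ∃ c₁ c₂ : ℝ, 0 < c₁ ∧
    ∀ᶠ p in atTop, c₁ ≤ A p / p ^ (m - 2) ∧ A p / p ^ (m - 2) ≤ c₂

/-- u ∈ C²(ℝⁿ \ {0}) ∩ Φᵏ(ℝⁿ) is an entire solution of inequality (101). -/
def IsEntireSol (n k : ℕ) (A f : ℝ → ℝ) (u : Euc n → ℝ) : Prop :=
  ContDiff ℝ 1 u ∧ ContDiffOn ℝ 2 u {(0 : Euc n)}ᶜ ∧
  ∃ V : Euc n → Euc n, ContDiff ℝ 1 V ∧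
    (∀ x, V x = A ‖gradient u x‖ • gradient u x) ∧
    ∃ hsym : ∀ x, (jacMatrix V x).IsHermitian,
      (∀ x, (hsym x).eigenvalues ∈ GammaK n k) ∧
      ∀ x, f (u x) ≤ (sigmaElem n k ((hsym x).eigenvalues)) ^ ((1:ℝ)/k)

/-- Ψ(p) = p (pA(p))^k − ∫₀^p (tA(t))^k dt. -/
def Psi (A : ℝ → ℝ) (k : ℕ) (p : ℝ) : ℝ :=
  p * (p * A p) ^ k - ∫ t in (0:ℝ)..p, (t * A t) ^ k

/-- Ψ⁻¹, the inverse of Ψ on [0,∞). -/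
def PsiInv (A : ℝ → ℝ) (k : ℕ) : ℝ → ℝ :=
  Function.invFunOn (Psi A k) (Ici 0)

/-- Generalized Keller–Osserman condition (110) with lower limit c. -/
def KO (A f : ℝ → ℝ) (k : ℕ) (c : ℝ) : Prop :=
  ∫⁻ s in Ioi c, ENNReal.ofReal (PsiInv A k (∫ t in c..s, f t ^ k))⁻¹ = ⊤

/-- [0,R) with R ∈ [0,∞]. -/
def IcoE (R : ℝ≥0∞) : Set ℝ := {r : ℝ | 0 ≤ r ∧ ENNReal.ofReal r < R}

/-- (0,R) with R ∈ [0,∞]. -/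
def IooE (R : ℝ≥0∞) : Set ℝ := {r : ℝ | 0 < r ∧ ENNReal.ofReal r < R}

/-- φ is a positive solution of the Cauchy problem (204) on [0,R). -/
def IsCauchySol (n k : ℕ) (A f : ℝ → ℝ) (a : ℝ) (R : ℝ≥0∞) (φ : ℝ → ℝ) : Prop :=
  ContinuousOn φ (IcoE R) ∧
  (∀ r ∈ IooE R, DifferentiableAt ℝ φ r) ∧
  ContinuousOn (deriv φ) (IooE R) ∧
  φ 0 = a ∧
  (∀ r ∈ IcoE R, 0 < φ r) ∧
  ∀ r ∈ IooE R,
    A |deriv φ r| * deriv φ r =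
      (n * r ^ ((k:ℝ) - n) / (n.choose k) * ∫ s in (0:ℝ)..r, s ^ (n-1) * f (φ s) ^ k) ^ ((1:ℝ)/k)


/-- The normalisation of the right-hand side of the Cauchy problem when `f ∘ φ` is constant. -/
lemma rpow_integral_const {n k : ℕ} (hk : 1 ≤ k) (hkn : k ≤ n) {r c : ℝ}
    (hr : 0 < r) (hc : 0 ≤ c) :
    (n * r ^ ((k : ℝ) - n) / (n.choose k) * ∫ s in (0 : ℝ)..r, s ^ (n - 1) * c ^ k)
        ^ ((1 : ℝ) / k) =
      (1 / (n.choose k : ℝ)) ^ ((1 : ℝ) / k) * r * c := by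
  have hn : (n : ℝ) ≠ 0 := by
    have : n ≠ 0 := by omega
    exact_mod_cast this
  have hk0 : k ≠ 0 := by omega
  have hrn : r ^ n ≠ 0 := (pow_pos hr n).ne'
  have hint : ∫ s in (0 : ℝ)..r, s ^ (n - 1) * c ^ k = r ^ n / n * c ^ k := by
    have h1 : n - 1 + 1 = n := by omega
    have h2 : ((n - 1 : ℕ) : ℝ) + 1 = n := by exact_mod_cast h1
    rw [intervalIntegral.integral_mul_const, integral_pow, h1, h2, zero_pow (by omega), sub_zero]
  have hbase : n * r ^ ((k : ℝ) - n) / (n.choose k) * (r ^ n / n * c ^ k) =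
      1 / (n.choose k : ℝ) * (r * c) ^ k := by
    rw [Real.rpow_sub hr, Real.rpow_natCast, Real.rpow_natCast, mul_pow]
    field_simp
  rw [hint, hbase, Real.mul_rpow (by positivity) (by positivity), one_div (k : ℝ),
    Real.pow_rpow_inv_natCast (by positivity) hk0, mul_assoc]

lemma Icc_subset_IcoE {R : ℝ≥0∞} {r : ℝ} (hr : r ∈ IooE R) : Icc 0 r ⊆ IcoE R :=
  fun _ hs => ⟨hs.1, (ENNReal.ofReal_le_ofReal hs.2).trans_lt hr.2⟩

lemma Ioo_subset_IooE {R : ℝ≥0∞} {r : ℝ} (hr : r ∈ IooE R) : Ioo 0 r ⊆ IooE R :=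
  fun _ hs => ⟨hs.1, (ENNReal.ofReal_le_ofReal hs.2.le).trans_lt hr.2⟩

namespace IsCauchySol

variable {n k : ℕ} {A f : ℝ → ℝ} {a : ℝ} {R : ℝ≥0∞} {φ : ℝ → ℝ}

lemma deriv_nonneg (hφ : IsCauchySol n k A f a R φ) (hA : Cond103 A) (hf : Cond109 f)
    {r : ℝ} (hr : r ∈ IooE R) : 0 ≤ deriv φ r := by
  obtain ⟨-, -, -, -, hpos, heq⟩ := hφ
  have hr0 : 0 < r := hr.1
  have hint : 0 ≤ ∫ s in (0 : ℝ)..r, s ^ (n - 1) * f (φ s) ^ k := by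
    refine intervalIntegral.integral_nonneg hr0.le fun s hs => ?_
    have := hf.2.1 _ (hpos s (Icc_subset_IcoE hr hs))
    exact mul_nonneg (pow_nonneg hs.1 _) (pow_nonneg this.le _)
  have hrhs : 0 ≤ A |deriv φ r| * deriv φ r := by
    rw [heq r hr]
    positivity
  by_contra! hneg
  exact hrhs.not_gt (mul_neg_of_pos_of_neg (hA.2.1 _ (abs_pos.2 hneg.ne)) hneg)

lemma monotoneOn_Icc (hφ : IsCauchySol n k A f a R φ) (hA : Cond103 A) (hf : Cond109 f)
    {r : ℝ} (hr : r ∈ IooE R) : MonotoneOn φ (Icc 0 r) := by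
  refine monotoneOn_of_deriv_nonneg (convex_Icc 0 r) (hφ.1.mono (Icc_subset_IcoE hr)) ?_ ?_ <;>
    rw [interior_Icc] <;> intro s hs
  · exact (hφ.2.1 s (Ioo_subset_IooE hr hs)).differentiableWithinAt
  · exact hφ.deriv_nonneg hA hf (Ioo_subset_IooE hr hs)

end IsCauchySol

/-- Estimates (401) and (403): for a positive solution of (204),
C(n,k)^{-1/k}·r·f(a) ≤ A(φ′(r))φ′(r) ≤ C(n,k)^{-1/k}·r·f(φ(r)) on (0,R). -/
theorem cauchySol_bounds
    (n k : ℕ) (hk : 1 ≤ k) (hkn : k ≤ n) (A f : ℝ → ℝ)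
    (hA : Cond103 A) (hf : Cond109 f)
    (a : ℝ) (ha : 0 < a) (R : ℝ≥0∞) (hR : 0 < R)
    (φ : ℝ → ℝ) (hφ : IsCauchySol n k A f a R φ) :
    ∀ r ∈ IooE R,
      (1 / (n.choose k : ℝ)) ^ ((1:ℝ)/k) * r * f a ≤ A (deriv φ r) * deriv φ r ∧
      A (deriv φ r) * deriv φ r ≤ (1 / (n.choose k : ℝ)) ^ ((1:ℝ)/k) * r * f (φ r) := by
  intro r hr
  have hr0 : 0 < r := hr.1
  have hmono := hφ.monotoneOn_Icc hA hf hr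
  have hderiv := hφ.deriv_nonneg hA hf hr
  obtain ⟨hcont, -, -, h0, hpos, heq⟩ := hφ
  have heq := heq r hr
  rw [abs_of_nonneg hderiv] at heq
  have hsub := Icc_subset_IcoE hr
  have h0r : (0 : ℝ) ∈ Icc 0 r := left_mem_Icc.2 hr0.le
  have hrr : r ∈ Icc 0 r := right_mem_Icc.2 hr0.le
  have hφpos : ∀ s ∈ Icc 0 r, 0 < φ s := fun s hs => hpos s (hsub hs)
  have hfpos : ∀ s ∈ Icc 0 r, 0 < f (φ s) := fun s hs => hf.2.1 _ (hφpos s hs)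
  have hlow : ∀ s ∈ Icc 0 r, f a ≤ f (φ s) := fun s hs =>
    hf.2.2 ha (hφpos s hs) (h0 ▸ hmono h0r hs hs.1)
  have hup : ∀ s ∈ Icc 0 r, f (φ s) ≤ f (φ r) := fun s hs =>
    hf.2.2 (hφpos s hs) (hφpos r hrr) (hmono hs hrr hs.2)
  have hfa : 0 < f a := hf.2.1 a ha
  have hint : IntervalIntegrable (fun s => s ^ (n - 1) * f (φ s) ^ k) volume 0 r := by
    refine ContinuousOn.intervalIntegrable_of_Icc hr0.le ?_
    exact (continuous_pow _).continuousOn.mul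
      ((hf.1.comp (hcont.mono hsub) fun s hs => hφpos s hs).pow k)
  have hconst : ∀ c : ℝ, IntervalIntegrable (fun s => s ^ (n - 1) * c ^ k) volume 0 r :=
    fun c => Continuous.intervalIntegrable (by fun_prop) 0 r
  have hint_nonneg : ∀ g : ℝ → ℝ, (∀ s ∈ Icc 0 r, 0 ≤ g s) →
      0 ≤ ∫ s in (0 : ℝ)..r, s ^ (n - 1) * g s ^ k := fun g hg =>
    intervalIntegral.integral_nonneg hr0.le fun s hs =>
      mul_nonneg (pow_nonneg hs.1 _) (pow_nonneg (hg s hs) _)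
  have hlow_nonneg := hint_nonneg (fun _ => f a) fun _ _ => hfa.le
  have hmid_nonneg := hint_nonneg (fun s => f (φ s)) fun s hs => (hfpos s hs).le
  rw [heq, ← rpow_integral_const hk hkn hr0 hfa.le,
    ← rpow_integral_const hk hkn hr0 (hfpos r hrr).le]
  constructor
  · gcongr
    refine intervalIntegral.integral_mono_on hr0.le (hconst _) hint fun s hs => ?_
    exact mul_le_mul_of_nonneg_left (pow_le_pow_left₀ hfa.le (hlow s hs) k) (pow_nonneg hs.1 _)
  · gcongr
    refine intervalIntegral.integral_mono_on hr0.le hint (hconst _) fun s hs => ?_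
    exact mul_le_mul_of_nonneg_left (pow_le_pow_left₀ (hfpos s hs).le (hup s hs) k)
      (pow_nonneg hs.1 _)
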